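/- Let n ≥ 2. Among the 2^{n(n−1)/2} real symmetric n × n matrices B with zero diagonal and all strict upper-diagonal entries in {−1, +1}, the number of B having n−1 as an eigenvalue is exactly 2^{n−1}. Equivalently, if B is chosen uniformly at random from this set, the probability that n−1 is an eigenvalue of B equals 2^{−(n−1)(n−2)/2}. -/

import Mathlib

open Matrix in
/-- If `x` is an eigenvector for the eigenvalue `card ι - 1` of a matrix with zero diagonal and
off-diagonal entries `±1`, then every row at which `|x|` is maximal is determined by `x`. -/
theorem entry_mul_eq_of_abs_maximal {ι : Type*} [Fintype ι] [DecidableEq ι] {B : Matrix ι ι ℝ}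
    (hdiag : ∀ i, B i i = 0) (hoff : ∀ i j, i ≠ j → B i j = 1 ∨ B i j = -1) {x : ι → ℝ}
    (hx : B *ᵥ x = ((Fintype.card ι : ℝ) - 1) • x) {i : ι} (hi : ∀ j, |x j| ≤ |x i|)
    {j : ι} (hij : i ≠ j) : B i j * x j = x i := by
  have hrow : ∑ k ∈ Finset.univ.erase i, B i k * x k = ((Fintype.card ι : ℝ) - 1) * x i := by
    have h := congrFun hx i
    simp only [mulVec, dotProduct, Pi.smul_apply, smul_eq_mul] at h
    rw [← Finset.add_sum_erase _ _ (Finset.mem_univ i), hdiag, zero_mul, zero_add] at h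
    exact h
  have hnonneg : ∀ k ∈ Finset.univ.erase i, 0 ≤ x i * (x i - B i k * x k) := by
    intro k hk
    have hprod : |x k * x i| ≤ x i * x i := by
      rw [abs_mul, ← abs_mul_abs_self (x i)]
      exact mul_le_mul_of_nonneg_right (hi k) (abs_nonneg _)
    obtain ⟨hl, hu⟩ := abs_le.mp hprod
    rcases hoff i k (Finset.ne_of_mem_erase hk).symm with h | h <;> rw [h] <;> linarith
  have hsum : ∑ k ∈ Finset.univ.erase i, x i * (x i - B i k * x k) = 0 := by
    rw [← Finset.mul_sum, Finset.sum_sub_distrib, hrow, Finset.sum_const, nsmul_eq_mul,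
      Finset.cast_card_erase_of_mem (Finset.mem_univ i), Finset.card_univ, sub_self, mul_zero]
  have hzero := (Finset.sum_eq_zero_iff_of_nonneg hnonneg).mp hsum j (by simp [hij.symm])
  rcases mul_eq_zero.mp hzero with h | h
  · have hj : x j = 0 := by simpa [h] using hi j
    rw [h, hj, mul_zero]
  · linarith

open Matrix in
/-- A matrix with zero diagonal and off-diagonal entries `±1` has the eigenvalue `card ι - 1` exactly when
its off-diagonal part has the form `s i * s j` for a sign vector `s`, which may be normalised to
be `1` at a chosen index. -/
theorem det_eq_zero_iff_exists_sign {ι : Type*} [Fintype ι] [DecidableEq ι] (o : ι)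
    {B : Matrix ι ι ℝ} (hdiag : ∀ i, B i i = 0)
    (hoff : ∀ i j, i ≠ j → B i j = 1 ∨ B i j = -1) :
    (((Fintype.card ι : ℝ) - 1) • (1 : Matrix ι ι ℝ) - B).det = 0 ↔
      ∃ s : ι → ℝ, s o = 1 ∧ (∀ i, s i = 1 ∨ s i = -1) ∧ ∀ i j, i ≠ j → B i j = s i * s j := by
  rw [← exists_mulVec_eq_zero_iff]
  constructor
  · rintro ⟨x, hx0, hx⟩
    have hx : B *ᵥ x = ((Fintype.card ι : ℝ) - 1) • x := by
      rw [sub_mulVec, smul_mulVec, one_mulVec, sub_eq_zero] at hx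
      exact hx.symm
    obtain ⟨m, -, hm⟩ := Finset.exists_max_image Finset.univ (fun k => |x k|) ⟨o, Finset.mem_univ o⟩
    have hmax : ∀ k, |x k| ≤ |x m| := fun k => hm k (Finset.mem_univ k)
    have habs : ∀ k, |x k| = |x m| := by
      intro k
      rcases eq_or_ne m k with rfl | hk
      · rfl
      · rw [← entry_mul_eq_of_abs_maximal hdiag hoff hx hmax hk]
        rcases hoff m k hk with h | h <;> simp [h]
    have hent : ∀ i j, i ≠ j → B i j * x j = x i := fun i j hij =>
      entry_mul_eq_of_abs_maximal hdiag hoff hx (fun k => (habs k).trans (habs i).symm |>.le) hij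
    have ho : x o ≠ 0 := by
      intro h
      refine hx0 (funext fun k => ?_)
      have := (habs k).trans (habs o).symm
      simpa [h] using this
    have hsign : ∀ i, x i / x o = 1 ∨ x i / x o = -1 := by
      intro i
      rcases abs_eq_abs.mp ((habs i).trans (habs o).symm) with h | h
      · left; rw [h, div_self ho]
      · right; rw [h, neg_div, div_self ho]
    refine ⟨fun i => x i / x o, div_self ho, hsign, fun i j hij => ?_⟩
    have hsq : x j / x o * (x j / x o) = 1 := by rcases hsign j with h | h <;> rw [h] <;> norm_num
    calc B i j = B i j * (x j / x o * (x j / x o)) := by rw [hsq, mul_one]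
      _ = B i j * x j / x o * (x j / x o) := by ring
      _ = x i / x o * (x j / x o) := by rw [hent i j hij]
  · rintro ⟨s, ho, hs, hB⟩
    refine ⟨s, fun h => by simp [h] at ho, ?_⟩
    rw [sub_mulVec, smul_mulVec, one_mulVec, sub_eq_zero]
    funext i
    simp only [mulVec, dotProduct, Pi.smul_apply, smul_eq_mul]
    rw [← Finset.add_sum_erase _ _ (Finset.mem_univ i), hdiag, zero_mul, zero_add,
      Finset.sum_congr rfl (g := fun _ => s i), Finset.sum_const, nsmul_eq_mul,
      Finset.cast_card_erase_of_mem (Finset.mem_univ i), Finset.card_univ]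
    intro j hj
    rw [hB i j (Finset.ne_of_mem_erase hj).symm]
    rcases hs j with h | h <;> rw [h] <;> ring

/-- The real sign attached to a Boolean. -/
def boolSign (b : Bool) : ℝ := if b then 1 else -1

theorem boolSign_eq_one_or (b : Bool) : boolSign b = 1 ∨ boolSign b = -1 := by
  cases b <;> simp [boolSign]

theorem boolSign_injective : Function.Injective boolSign := by
  intro a b h
  cases a <;> cases b <;> first | rfl | norm_num [boolSign] at h

theorem exists_boolSign_eq {r : ℝ} (h : r = 1 ∨ r = -1) : ∃ b, boolSign b = r := by
  rcases h with rfl | rfl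
  · exact ⟨true, by simp [boolSign]⟩
  · exact ⟨false, by simp [boolSign]⟩

theorem Set.ncard_range_of_injective_of_fintype {α β : Type*} [Fintype α] {f : α → β}
    (hf : Function.Injective f) : (Set.range f).ncard = Fintype.card α := by
  rw [← Set.image_univ, Set.ncard_image_of_injective _ hf, Set.ncard_univ, Nat.card_eq_fintype_card]

/-- The number of symmetric sign matrices with zero diagonal. -/
theorem ncard_symm_sign_matrices (ι : Type*) [Fintype ι] [DecidableEq ι] :
    Set.ncard {B : Matrix ι ι ℝ | B.IsSymm ∧ (∀ i, B i i = 0) ∧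
      ∀ i j, i ≠ j → B i j = 1 ∨ B i j = -1} = 2 ^ (Fintype.card ι).choose 2 := by
  let F : ({e : Sym2 ι // ¬ e.IsDiag} → Bool) → Matrix ι ι ℝ := fun f i j =>
    if h : i = j then 0 else boolSign (f ⟨s(i, j), by simpa using h⟩)
  have hF : Function.Injective F := by
    intro f g hfg
    funext ⟨e, he⟩
    induction e using Sym2.ind with
    | _ i j =>
      have hij : i ≠ j := by simpa using he
      have h := congrFun (congrFun hfg i) j
      simp only [F, dif_neg hij] at h
      exact boolSign_injective h
  have hrange : {B : Matrix ι ι ℝ | B.IsSymm ∧ (∀ i, B i i = 0) ∧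
      ∀ i j, i ≠ j → B i j = 1 ∨ B i j = -1} = Set.range F := by
    ext B
    constructor
    · rintro ⟨hsymm, hdiag, hoff⟩
      have hex : ∀ e : {e : Sym2 ι // ¬ e.IsDiag}, ∃ b, ∀ i j, e.1 = s(i, j) →
          boolSign b = B i j := by
        rintro ⟨e, he⟩
        induction e using Sym2.ind with
        | _ i j =>
          obtain ⟨b, hb⟩ := exists_boolSign_eq (hoff i j (by simpa using he))
          refine ⟨b, fun k l hkl => ?_⟩
          rcases Sym2.eq_iff.mp hkl with ⟨rfl, rfl⟩ | ⟨rfl, rfl⟩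
          · exact hb
          · rw [hb, hsymm.apply]
      choose f hf using hex
      refine ⟨f, Matrix.ext fun i j => ?_⟩
      by_cases hij : i = j
      · subst hij
        simp [F, hdiag]
      · simp only [F, dif_neg hij]
        exact hf _ i j rfl
    · rintro ⟨f, rfl⟩
      refine ⟨Matrix.IsSymm.ext fun i j => ?_, fun i => by simp [F], fun i j hij => ?_⟩
      · simp only [F, eq_comm (a := j) (b := i), Sym2.eq_swap (a := j) (b := i)]
      · simp only [F, dif_neg hij]
        exact boolSign_eq_one_or _
  rw [hrange, Set.ncard_range_of_injective_of_fintype hF, Fintype.card_fun, Fintype.card_bool,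
    Sym2.card_subtype_not_diag]

/-- The number of matrices with zero diagonal whose off-diagonal part is `s i * s j` for a sign
vector `s`. -/
theorem ncard_rank_one_sign_matrices (m : ℕ) :
    Set.ncard {B : Matrix (Fin (m + 1)) (Fin (m + 1)) ℝ | (∀ i, B i i = 0) ∧
      ∃ s : Fin (m + 1) → ℝ, s 0 = 1 ∧ (∀ i, s i = 1 ∨ s i = -1) ∧
        ∀ i j, i ≠ j → B i j = s i * s j} = 2 ^ m := by
  let v : (Fin m → Bool) → Fin (m + 1) → ℝ := fun f => Fin.cons 1 fun k => boolSign (f k)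
  let G : (Fin m → Bool) → Matrix (Fin (m + 1)) (Fin (m + 1)) ℝ := fun f i j =>
    if i = j then 0 else v f i * v f j
  have hG : Function.Injective G := by
    intro f g hfg
    funext k
    have h := congrFun (congrFun hfg 0) k.succ
    simp only [G, v, if_neg (Fin.succ_ne_zero k).symm, Fin.cons_zero, Fin.cons_succ, one_mul] at h
    exact boolSign_injective h
  have hrange : {B : Matrix (Fin (m + 1)) (Fin (m + 1)) ℝ | (∀ i, B i i = 0) ∧
      ∃ s : Fin (m + 1) → ℝ, s 0 = 1 ∧ (∀ i, s i = 1 ∨ s i = -1) ∧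
        ∀ i j, i ≠ j → B i j = s i * s j} = Set.range G := by
    ext B
    constructor
    · rintro ⟨hdiag, s, h0, hs, hB⟩
      choose f hf using fun k : Fin m => exists_boolSign_eq (hs k.succ)
      have hv : v f = s := by
        funext i
        refine Fin.cases ?_ (fun k => ?_) i
        · simp [v, h0]
        · simp [v, hf]
      refine ⟨f, Matrix.ext fun i j => ?_⟩
      by_cases hij : i = j
      · subst hij
        simp [G, hdiag]
      · simp only [G, if_neg hij, hv, hB i j hij]
    · rintro ⟨f, rfl⟩
      refine ⟨fun i => by simp [G], v f, rfl, fun i => ?_, fun i j hij => by simp [G, hij]⟩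
      refine Fin.cases (Or.inl rfl) (fun k => ?_) i
      simpa [v] using boolSign_eq_one_or (f k)
  rw [hrange, Set.ncard_range_of_injective_of_fintype hG, Fintype.card_fun, Fintype.card_bool,
    Fintype.card_fin]


/-- Among the `2 ^ (n*(n-1)/2)` real symmetric `n × n` matrices `B` with zero diagonal and
`±1` strict off-diagonal entries, exactly `2 ^ (n-1)` have `n - 1` as an eigenvalue; hence
the probability of this event under the uniform measure is `2 ^ (-(n-1)*(n-2)/2)`. -/
theorem count_eigenvalue_n_sub_one_real
    (n : ℕ) (hn : 2 ≤ n) :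
    Set.ncard {B : Matrix (Fin n) (Fin n) ℝ | B.IsSymm ∧ (∀ i, B i i = 0) ∧
        ∀ i j, i ≠ j → B i j = 1 ∨ B i j = -1} = 2 ^ (n * (n - 1) / 2) ∧
    Set.ncard {B : Matrix (Fin n) (Fin n) ℝ | (B.IsSymm ∧ (∀ i, B i i = 0) ∧
        ∀ i j, i ≠ j → B i j = 1 ∨ B i j = -1) ∧
        (((n : ℝ) - 1) • (1 : Matrix (Fin n) (Fin n) ℝ) - B).det = 0} = 2 ^ (n - 1) := by
  refine ⟨by rw [ncard_symm_sign_matrices, Fintype.card_fin, Nat.choose_two_right], ?_⟩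
  obtain ⟨m, rfl⟩ : ∃ m, n = m + 1 := ⟨n - 1, by omega⟩
  rw [Nat.add_sub_cancel, ← ncard_rank_one_sign_matrices m]
  congr 1
  ext B
  constructor
  · rintro ⟨⟨-, hdiag, hoff⟩, hdet⟩
    refine ⟨hdiag, (det_eq_zero_iff_exists_sign 0 hdiag hoff).mp ?_⟩
    rwa [Fintype.card_fin]
  · rintro ⟨hdiag, s, h0, hs, hB⟩
    have hoff : ∀ i j, i ≠ j → B i j = 1 ∨ B i j = -1 := by
      intro i j hij
      rw [hB i j hij]
      rcases hs i with hi | hi <;> rcases hs j with hj | hj <;> simp [hi, hj]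
    have hsymm : B.IsSymm := by
      refine Matrix.IsSymm.ext fun i j => ?_
      rcases eq_or_ne i j with rfl | hij
      · rfl
      · rw [hB i j hij, hB j i hij.symm, mul_comm]
    have hdet := (det_eq_zero_iff_exists_sign 0 hdiag hoff).mpr ⟨s, h0, hs, hB⟩
    rw [Fintype.card_fin] at hdet
    exact ⟨⟨hsymm, hdiag, hoff⟩, hdet⟩
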